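/- Let m be a positive integer and let f_i (1 ≤ i ≤ n+1) be smooth real functions with f_i' nowhere zero. Suppose x_{n+1} = x_{n+1}(x_1,…,x_n) is a smooth local solution of f_1(x_1)+⋯+f_n(x_n)+f_{n+1}(x_{n+1}) = 0, so that ∂x_{n+1}/∂x_j = −f_j'(x_j)/f_{n+1}'(x_{n+1}). Set A = Σ_{i=1}^{n+1} (f_i')^{2m/(2m-1)}, η = A^{-1/(2m)}((f_1')^{1/(2m-1)},…,(f_{n+1}')^{1/(2m-1)}) (evaluated at (x_1,…,x_n,x_{n+1}(x_1,…,x_n))), and p_{x_j} = e_j − (f_j'/f_{n+1}') e_{n+1}. Then ∂η/∂x_j = Σ_{k=1}^n η_j^k p_{x_k} where η_j^j = (A^{-(2m+1)/(2m)}/(2m-1)) [ (f_j')^{2m/(2m-1)} (f_{n+1}')^{-(2m-2)/(2m-1)} f_{n+1}'' + (f_j')^{-(2m-2)/(2m-1)} f_j'' Σ_{i≠j, 1≤i≤n+1} (f_i')^{2m/(2m-1)} ] and, for k ≠ j, η_j^k = (A^{-(2m+1)/(2m)}/(2m-1)) (f_k')^{1/(2m-1)} [ f_j' (f_{n+1}')^{-(2m-2)/(2m-1)}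 f_{n+1}'' − (f_j')^{1/(2m-1)} f_j'' ]. Consequently (1/n) Σ_{j=1}^n η_j^j = (A^{-(2m+1)/(2m)}/(n(2m-1))) Σ_{j=1}^{n+1} [ (f_j')^{-(2m-2)/(2m-1)} f_j'' Σ_{i≠j} (f_i')^{2m/(2m-1)} ]. -/

import Mathlib

/-- The real `(2m-1)`-th root of `y`: the unique real number `s` with `s^(2m-1) = y`.
For `y ≠ 0`, the fractional power `y^(p/(2m-1))` is interpreted as `(oddRoot m y)^p`. -/
noncomputable def oddRoot (m : ℕ) (y : ℝ) : ℝ :=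
  Real.sign y * |y| ^ ((2 * (m : ℝ) - 1)⁻¹)

/-- The point `(x₁,…,x_n, x_{n+1}(x₁,…,x_n))` on the separable hypersurface,
where `x_{n+1} = g(x₁,…,x_n)` is the local solution. -/
noncomputable def ptSep (n : ℕ) (g : (Fin n → ℝ) → ℝ) (x : Fin n → ℝ) :
    Fin (n + 1) → ℝ :=
  (Fin.snoc x (g x) : Fin (n + 1) → ℝ)

/-- `fᵢ'` evaluated at the `i`-th coordinate of the point of the hypersurface. -/
noncomputable def dSep (n : ℕ) (f : Fin (n + 1) → ℝ → ℝ) (g : (Fin n → ℝ) → ℝ)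
    (x : Fin n → ℝ) (i : Fin (n + 1)) : ℝ :=
  deriv (f i) (ptSep n g x i)

/-- `fᵢ''` evaluated at the `i`-th coordinate of the point of the hypersurface. -/
noncomputable def d2Sep (n : ℕ) (f : Fin (n + 1) → ℝ → ℝ) (g : (Fin n → ℝ) → ℝ)
    (x : Fin n → ℝ) (i : Fin (n + 1)) : ℝ :=
  deriv (deriv (f i)) (ptSep n g x i)

/-- `A = Σ_{i=1}^{n+1} (fᵢ')^{2m/(2m-1)}`. -/
noncomputable def AsepG (m n : ℕ) (f : Fin (n + 1) → ℝ → ℝ) (g : (Fin n → ℝ) → ℝ)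
    (x : Fin n → ℝ) : ℝ :=
  ∑ i, (oddRoot m (dSep n f g x i)) ^ (2 * m)

/-- The Birkhoff–Gauss map `η = A^{-1/(2m)}((f₁')^{1/(2m-1)},…,(f_{n+1}')^{1/(2m-1)})`
as a function of the local coordinates `(x₁,…,x_n)`. -/
noncomputable def etaSepG (m n : ℕ) (f : Fin (n + 1) → ℝ → ℝ) (g : (Fin n → ℝ) → ℝ)
    (x : Fin n → ℝ) : Fin (n + 1) → ℝ :=
  fun i => (AsepG m n f g x) ^ (-(1 : ℝ) / (2 * (m : ℝ)))
    * oddRoot m (dSep n f g x i)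

/-- The tangent vector `p_{x_j} = e_j - (f_j'/f_{n+1}') e_{n+1}`. -/
noncomputable def pX (n : ℕ) (f : Fin (n + 1) → ℝ → ℝ) (g : (Fin n → ℝ) → ℝ)
    (x : Fin n → ℝ) (j : Fin n) : Fin (n + 1) → ℝ :=
  (Fin.snoc (Pi.single j 1)
    (-(dSep n f g x j.castSucc / dSep n f g x (Fin.last n))) : Fin (n + 1) → ℝ)

/-- The coefficients `η_j^k` in `∂η/∂x_j = Σ_k η_j^k p_{x_k}`. -/
noncomputable def etaCoefSep (m n : ℕ) (f : Fin (n + 1) → ℝ → ℝ) (g : (Fin n → ℝ) → ℝ)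
    (x : Fin n → ℝ) (j k : Fin n) : ℝ :=
  if k = j then
    ((AsepG m n f g x) ^ (-(2 * (m : ℝ) + 1) / (2 * (m : ℝ))) / (2 * (m : ℝ) - 1))
      * ((oddRoot m (dSep n f g x j.castSucc)) ^ (2 * m)
          * ((oddRoot m (dSep n f g x (Fin.last n))) ^ (2 * m - 2))⁻¹
          * d2Sep n f g x (Fin.last n)
        + ((oddRoot m (dSep n f g x j.castSucc)) ^ (2 * m - 2))⁻¹
          * d2Sep n f g x j.castSucc
          * ∑ i ∈ Finset.univ.erase j.castSucc, (oddRoot m (dSep n f g x i)) ^ (2 * m))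
  else
    ((AsepG m n f g x) ^ (-(2 * (m : ℝ) + 1) / (2 * (m : ℝ))) / (2 * (m : ℝ) - 1))
      * oddRoot m (dSep n f g x k.castSucc)
      * (dSep n f g x j.castSucc
          * ((oddRoot m (dSep n f g x (Fin.last n))) ^ (2 * m - 2))⁻¹
          * d2Sep n f g x (Fin.last n)
        - oddRoot m (dSep n f g x j.castSucc) * d2Sep n f g x j.castSucc)

theorem hasDerivAt_oddRoot {m : ℕ} (hm : 1 ≤ m) {y : ℝ} (hy : y ≠ 0) :
    HasDerivAt (oddRoot m) ((2 * (m : ℝ) - 1)⁻¹ * (oddRoot m y ^ (2 * m - 2))⁻¹) y := by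
  have hm' : (1 : ℝ) ≤ m := by exact_mod_cast hm
  have hp : (2 * (m : ℝ) - 1) ≠ 0 := by linarith
  have habs : 0 < |y| := abs_pos.mpr hy
  have hs2 : Real.sign y * Real.sign y = 1 := by
    rcases Real.sign_apply_eq_of_ne_zero y hy with h | h <;> simp [h]
  have hpow : (oddRoot m y ^ (2 * m - 2))⁻¹ = |y| ^ ((2 * (m : ℝ) - 1)⁻¹ - 1) := by
    have h2 : 2 * m - 2 = 2 * (m - 1) := by omega
    rw [oddRoot, mul_pow, h2, pow_mul (Real.sign y), sq, hs2, one_pow, one_mul,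
      ← Real.rpow_mul_natCast habs.le, ← Real.rpow_neg habs.le]
    congr 1
    push_cast [Nat.cast_sub hm]
    field_simp
    ring
  have hsign : ∀ᶠ z in nhds y, Real.sign z = Real.sign y := by
    rcases hy.lt_or_gt with h | h
    · filter_upwards [gt_mem_nhds h] with z hz
      rw [Real.sign_of_neg hz, Real.sign_of_neg h]
    · filter_upwards [lt_mem_nhds h] with z hz
      rw [Real.sign_of_pos hz, Real.sign_of_pos h]
  have hd : HasDerivAt (fun z : ℝ => |z|) (Real.sign y) y := by
    rcases hy.lt_or_gt with h | h
    · simpa [Real.sign_of_neg h] using hasDerivAt_abs_neg h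
    · simpa [Real.sign_of_pos h] using hasDerivAt_abs_pos h
  have hmain := (hd.rpow_const (p := (2 * (m : ℝ) - 1)⁻¹) (Or.inl habs.ne')).const_mul
    (Real.sign y)
  refine (hmain.congr_of_eventuallyEq ?_).congr_deriv ?_
  · filter_upwards [hsign] with z hz
    rw [oddRoot, hz]
  · rw [hpow]
    linear_combination (2 * (m : ℝ) - 1)⁻¹ * |y| ^ ((2 * (m : ℝ) - 1)⁻¹ - 1) * hs2

theorem oddRoot_ne_zero (m : ℕ) {y : ℝ} (hy : y ≠ 0) : oddRoot m y ≠ 0 :=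
  mul_ne_zero (by simpa [Real.sign_eq_zero_iff] using hy)
    (Real.rpow_pos_of_pos (abs_pos.mpr hy) _).ne'

theorem oddRoot_pow {m : ℕ} (hm : 1 ≤ m) {y : ℝ} (hy : y ≠ 0) :
    oddRoot m y ^ (2 * m - 1) = y := by
  have hm' : (1 : ℝ) ≤ m := by exact_mod_cast hm
  have hp : (2 * (m : ℝ) - 1) ≠ 0 := by linarith
  have hcast : ((2 * m - 1 : ℕ) : ℝ) = 2 * m - 1 := by
    rw [Nat.cast_sub (by omega)]
    push_cast
    ring
  have hodd : Odd (2 * m - 1) := ⟨m - 1, by omega⟩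
  rw [oddRoot, mul_pow, ← Real.rpow_mul_natCast (abs_nonneg y), hcast, inv_mul_cancel₀ hp,
    Real.rpow_one]
  rcases hy.lt_or_gt with h | h
  · rw [Real.sign_of_neg h, hodd.neg_one_pow, abs_of_neg h]
    ring
  · rw [Real.sign_of_pos h, one_pow, abs_of_pos h, one_mul]

section

variable {m n : ℕ} {f : Fin (n + 1) → ℝ → ℝ} {g : (Fin n → ℝ) → ℝ} {x : Fin n → ℝ}

theorem AsepG_pos (hd : ∀ i, dSep n f g x i ≠ 0) : 0 < AsepG m n f g x :=
  Finset.sum_pos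
    (fun i _ => (even_two_mul m).pow_pos (oddRoot_ne_zero m (hd i))) Finset.univ_nonempty

theorem AsepG_rpow (hm : 1 ≤ m) (hA : 0 < AsepG m n f g x) :
    AsepG m n f g x ^ (-(1 : ℝ) / (2 * (m : ℝ)))
      = AsepG m n f g x ^ (-(2 * (m : ℝ) + 1) / (2 * (m : ℝ))) * AsepG m n f g x := by
  have hm' : (m : ℝ) ≠ 0 := by positivity
  conv_rhs => rw [← Real.rpow_add_one hA.ne']
  congr 1
  field_simp
  ring

/-- The derivative of `fᵢ'^{1/(2m-1)}` with respect to the `i`-th coordinate. -/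
noncomputable def rootDeriv (m n : ℕ) (f : Fin (n + 1) → ℝ → ℝ) (g : (Fin n → ℝ) → ℝ)
    (x : Fin n → ℝ) (i : Fin (n + 1)) : ℝ :=
  (2 * (m : ℝ) - 1)⁻¹ * (oddRoot m (dSep n f g x i) ^ (2 * m - 2))⁻¹ * d2Sep n f g x i

theorem sum_mul_pX (a : Fin (n + 1) → ℝ) (j : Fin n) :
    ∑ i, a i * pX n f g x j i
      = a j.castSucc
        - a (Fin.last n) * (dSep n f g x j.castSucc / dSep n f g x (Fin.last n)) := by
  simp [Fin.sum_univ_castSucc, pX, Pi.single_apply, sub_eq_add_neg]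

theorem etaCoefSep_eq (hm : 1 ≤ m) (hd : ∀ i, dSep n f g x i ≠ 0) (j k : Fin n) :
    etaCoefSep m n f g x j k
      = AsepG m n f g x ^ (-(2 * (m : ℝ) + 1) / (2 * (m : ℝ)))
        * ((if k = j then AsepG m n f g x * rootDeriv m n f g x j.castSucc else 0)
          - oddRoot m (dSep n f g x k.castSucc) * (dSep n f g x j.castSucc
            * (rootDeriv m n f g x j.castSucc - rootDeriv m n f g x (Fin.last n)))) := by
  obtain ⟨l, rfl⟩ : ∃ l, m = l + 1 := ⟨m - 1, by omega⟩
  have hp : 2 * (((l + 1 : ℕ) : ℝ)) - 1 ≠ 0 := by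
    have hl := l.cast_nonneg (α := ℝ)
    push_cast
    linarith
  have hr := oddRoot_ne_zero (l + 1) (hd j.castSucc)
  have hN := oddRoot_ne_zero (l + 1) (hd (Fin.last n))
  have hpow := oddRoot_pow hm (hd j.castSucc)
  rw [show 2 * (l + 1) - 1 = 2 * l + 1 by omega] at hpow
  unfold etaCoefSep rootDeriv
  rw [show 2 * (l + 1) - 2 = 2 * l by omega]
  split_ifs with h
  · subst h
    have hA : AsepG (l + 1) n f g x = oddRoot (l + 1) (dSep n f g x k.castSucc) ^ (2 * (l + 1))
        + ∑ i ∈ Finset.univ.erase k.castSucc, oddRoot (l + 1) (dSep n f g x i) ^ (2 * (l + 1)) :=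
      (Finset.add_sum_erase _ _ (Finset.mem_univ _)).symm
    generalize AsepG (l + 1) n f g x ^ _ = P
    rw [hA]
    generalize ∑ i ∈ Finset.univ.erase k.castSucc,
      oddRoot (l + 1) (dSep n f g x i) ^ (2 * (l + 1)) = S
    generalize oddRoot (l + 1) (dSep n f g x k.castSucc) = r at *
    rw [← hpow]
    field_simp
    ring
  · generalize AsepG (l + 1) n f g x ^ _ = P
    generalize oddRoot (l + 1) (dSep n f g x j.castSucc) = r at *
    rw [← hpow]
    field_simp
    ring

theorem sum_etaCoefSep_smul_pX (hm : 1 ≤ m) (hd : ∀ i, dSep n f g x i ≠ 0) (j : Fin n)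
    (i : Fin (n + 1)) :
    ∑ k, etaCoefSep m n f g x j k * pX n f g x k i
      = AsepG m n f g x ^ (-(2 * (m : ℝ) + 1) / (2 * (m : ℝ)))
        * (AsepG m n f g x * (rootDeriv m n f g x i * pX n f g x j i)
          - oddRoot m (dSep n f g x i) * (dSep n f g x j.castSucc
            * (rootDeriv m n f g x j.castSucc - rootDeriv m n f g x (Fin.last n)))) := by
  simp only [etaCoefSep_eq hm hd]
  refine Fin.lastCases ?_ (fun i => ?_) i
  · have hA : AsepG m n f g x = ∑ k : Fin n, oddRoot m (dSep n f g x k.castSucc)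
          * dSep n f g x k.castSucc
        + oddRoot m (dSep n f g x (Fin.last n)) * dSep n f g x (Fin.last n) := by
      have hmul : ∀ i, oddRoot m (dSep n f g x i) ^ (2 * m)
          = oddRoot m (dSep n f g x i) * dSep n f g x i := fun i => by
        conv_rhs => rw [mul_comm]; enter [1]; rw [← oddRoot_pow hm (hd i)]
        rw [← pow_succ]
        congr 1
        omega
      simp only [AsepG, hmul, Fin.sum_univ_castSucc]
    have hN := hd (Fin.last n)
    generalize AsepG m n f g x ^ (-(2 * (m : ℝ) + 1) / (2 * (m : ℝ))) = P
    simp only [pX, Fin.snoc_last]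
    set T := dSep n f g x j.castSucc
      * (rootDeriv m n f g x j.castSucc - rootDeriv m n f g x (Fin.last n)) with hT
    have hsum : ∑ k : Fin n, P * ((if k = j then
          AsepG m n f g x * rootDeriv m n f g x j.castSucc else 0)
          - oddRoot m (dSep n f g x k.castSucc) * T)
          * -(dSep n f g x k.castSucc / dSep n f g x (Fin.last n))
        = -(P / dSep n f g x (Fin.last n)) * (AsepG m n f g x * rootDeriv m n f g x j.castSucc
            * dSep n f g x j.castSucc
          - T * ∑ k : Fin n, oddRoot m (dSep n f g x k.castSucc) * dSep n f g x k.castSucc) := by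
      have hj : AsepG m n f g x * rootDeriv m n f g x j.castSucc * dSep n f g x j.castSucc
          = ∑ k : Fin n, (if k = j then AsepG m n f g x * rootDeriv m n f g x j.castSucc else 0)
            * dSep n f g x k.castSucc := by simp
      rw [hj, Finset.mul_sum, ← Finset.sum_sub_distrib, Finset.mul_sum]
      refine Finset.sum_congr rfl fun k _ => ?_
      ring
    rw [hsum, eq_sub_of_add_eq hA.symm]
    field_simp
    rw [hT]
    ring
  · simp only [pX, Fin.snoc_castSucc, Pi.single_apply]
    rw [Finset.sum_eq_single i]
    · by_cases h : i = j <;> simp [h]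
    · intro k _ hk
      simp [hk.symm]
    · simp

theorem hasFDerivAt_oddRoot_dSep (hm : 1 ≤ m) (hf : ∀ i, ContDiff ℝ (⊤ : ℕ∞) (f i))
    (hd : ∀ i, dSep n f g x i ≠ 0) (hg : DifferentiableAt ℝ g x)
    (hgd : ∀ j : Fin n, fderiv ℝ g x (Pi.single j 1)
      = -(dSep n f g x j.castSucc / dSep n f g x (Fin.last n))) (i : Fin (n + 1)) :
    ∃ L : (Fin n → ℝ) →L[ℝ] ℝ, HasFDerivAt (fun z => oddRoot m (dSep n f g z i)) L x ∧
      ∀ j, L (Pi.single j 1) = rootDeriv m n f g x i * pX n f g x j i := by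
  have hpt : ∃ L : (Fin n → ℝ) →L[ℝ] ℝ, HasFDerivAt (fun z => ptSep n g z i) L x ∧
      ∀ j, L (Pi.single j 1) = pX n f g x j i := by
    refine Fin.lastCases ?_ (fun i => ?_) i
    · exact ⟨fderiv ℝ g x, by simpa [ptSep] using hg.hasFDerivAt, by simpa [pX] using hgd⟩
    · exact ⟨ContinuousLinearMap.proj i, by simpa [ptSep] using hasFDerivAt_apply i x,
        by simp [pX]⟩
  obtain ⟨L, hL, hLj⟩ := hpt
  have hf2 : HasDerivAt (deriv (f i)) (d2Sep n f g x i) (ptSep n g x i) :=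
    ((contDiff_infty_iff_deriv.1 (hf i)).2.differentiable (by simp) _).hasDerivAt
  have hcomp := ((hasDerivAt_oddRoot hm (hd i)).comp (ptSep n g x i) hf2).comp_hasFDerivAt x hL
  refine ⟨_, hcomp, fun j => ?_⟩
  simp [hLj, rootDeriv]

theorem fderiv_etaSepG (hm : 1 ≤ m) (hf : ∀ i, ContDiff ℝ (⊤ : ℕ∞) (f i))
    (hd : ∀ i, dSep n f g x i ≠ 0) (hg : DifferentiableAt ℝ g x)
    (hgd : ∀ j : Fin n, fderiv ℝ g x (Pi.single j 1)
      = -(dSep n f g x j.castSucc / dSep n f g x (Fin.last n))) (j : Fin n) :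
    fderiv ℝ (etaSepG m n f g) x (Pi.single j 1)
      = ∑ k, etaCoefSep m n f g x j k • pX n f g x k := by
  choose L hL hLj using hasFDerivAt_oddRoot_dSep hm hf hd hg hgd
  have hA := AsepG_pos (m := m) hd
  have hm' : (m : ℝ) ≠ 0 := by positivity
  have hAd : HasFDerivAt (AsepG m n f g) _ x :=
    HasFDerivAt.fun_sum (u := Finset.univ) fun i _ => (hL i).pow (2 * m)
  have heta : HasFDerivAt (etaSepG m n f g) _ x := hasFDerivAt_pi.2 fun i =>
    (hAd.rpow_const (p := -(1 : ℝ) / (2 * (m : ℝ))) (Or.inl hA.ne')).mul (hL i)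
  rw [heta.fderiv]
  ext i
  have hsub : -(1 : ℝ) / (2 * (m : ℝ)) - 1 = -(2 * (m : ℝ) + 1) / (2 * (m : ℝ)) := by
    field_simp
    ring
  have hN := hd (Fin.last n)
  have hsum := sum_mul_pX (f := f) (g := g) (x := x)
    (fun i => dSep n f g x i * rootDeriv m n f g x i) j
  simp only [Finset.sum_apply, Pi.smul_apply, smul_eq_mul, sum_etaCoefSep_smul_pX hm hd,
    ContinuousLinearMap.pi_apply, add_apply, smul_apply,
    sum_apply, hLj, hsub, AsepG_rpow hm hA, oddRoot_pow hm (hd _),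
    nsmul_eq_mul, mul_assoc, ← Finset.mul_sum] at hsum ⊢
  rw [hsum]
  push_cast
  field_simp
  ring

theorem sum_etaCoefSep_diag :
    ∑ j, etaCoefSep m n f g x j j
      = (AsepG m n f g x ^ (-(2 * (m : ℝ) + 1) / (2 * (m : ℝ))) / (2 * (m : ℝ) - 1))
        * ∑ j : Fin (n + 1), (oddRoot m (dSep n f g x j) ^ (2 * m - 2))⁻¹ * d2Sep n f g x j
          * ∑ i ∈ Finset.univ.erase j, oddRoot m (dSep n f g x i) ^ (2 * m) := by
  have hlast : ∑ i ∈ Finset.univ.erase (Fin.last n), oddRoot m (dSep n f g x i) ^ (2 * m)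
      = ∑ j : Fin n, oddRoot m (dSep n f g x j.castSucc) ^ (2 * m) := by
    rw [← add_right_inj (oddRoot m (dSep n f g x (Fin.last n)) ^ (2 * m)),
      Finset.add_sum_erase _ (fun i => oddRoot m (dSep n f g x i) ^ (2 * m)) (Finset.mem_univ _),
      Fin.sum_univ_castSucc, add_comm]
  simp only [etaCoefSep, if_true, ← Finset.mul_sum, Finset.sum_add_distrib]
  rw [Fin.sum_univ_castSucc, hlast, ← Finset.sum_mul, ← Finset.sum_mul]
  ring

end

/-- for a separable hypersurface `f₁(x₁)+⋯+f_{n+1}(x_{n+1}) = 0`,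
`∂η/∂x_j = Σ_k η_j^k p_{x_k}` with the coefficients above, and consequently the
mean curvature `(1/n) Σ_j η_j^j` is given by formula (5.1). -/
theorem etaSepG_deriv_and_mean_curvature (m n : ℕ) (hm : 1 ≤ m)
    (f : Fin (n + 1) → ℝ → ℝ)
    (hf : ∀ i, ContDiff ℝ (⊤ : ℕ∞) (f i))
    (hf1 : ∀ i, ∀ t : ℝ, deriv (f i) t ≠ 0)
    (U : Set (Fin n → ℝ)) (hU : IsOpen U)
    (g : (Fin n → ℝ) → ℝ) (hg : ContDiffOn ℝ (⊤ : ℕ∞) g U)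
    (hsol : ∀ x ∈ U, (∑ j : Fin n, f j.castSucc (x j)) + f (Fin.last n) (g x) = 0)
    (hgd : ∀ x ∈ U, ∀ j : Fin n,
      fderiv ℝ g x (Pi.single j 1)
        = -(deriv (f j.castSucc) (x j) / deriv (f (Fin.last n)) (g x))) :
    ∀ x ∈ U,
      (∀ j : Fin n,
        fderiv ℝ (etaSepG m n f g) x (Pi.single j 1)
          = ∑ k, etaCoefSep m n f g x j k • pX n f g x k) ∧
      (1 / (n : ℝ)) * ∑ j, etaCoefSep m n f g x j j
        = ((AsepG m n f g x) ^ (-(2 * (m : ℝ) + 1) / (2 * (m : ℝ)))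
              / ((n : ℝ) * (2 * (m : ℝ) - 1)))
          * ∑ j : Fin (n + 1), ((oddRoot m (dSep n f g x j)) ^ (2 * m - 2))⁻¹
              * d2Sep n f g x j
              * ∑ i ∈ Finset.univ.erase j, (oddRoot m (dSep n f g x i)) ^ (2 * m) := by
  intro x hx
  have hd : ∀ i, dSep n f g x i ≠ 0 := fun i => hf1 i _
  have hgx : DifferentiableAt ℝ g x :=
    ((hg.contDiffAt (hU.mem_nhds hx)).differentiableAt (by simp))
  refine ⟨fderiv_etaSepG hm hf hd hgx fun j => ?_, ?_⟩
  · simpa [dSep, ptSep] using hgd x hx j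
  · rw [sum_etaCoefSep_diag, ← mul_assoc, div_mul_div_comm, one_mul]
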